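/- Let ħ, a ∈ ℂ with ħ ≠ 0, and let g ∈ ℂ[[X]] be a formal power series satisfying ħ²·X²·g″ = 12·ħ²·g + 6·X²·g² + X³ + a·X², where g″ denotes the second formal derivative of g. Define the formal power series A := −2ħ³ + ħ·X³·g′ and B := ħ² + X²·g, and set h₆ := A²/2 − 2·B³ − (a + X)·X⁴·B. Then coeff_k(h₆) = 0 for k = 0, 1, 2, 3, 4, and coeff₅(h₆) = ħ². -/

import Mathlib

open PowerSeries

/-- **The Hamiltonian has a simple pole with residue `hbar²` at a movable
pole of Painlevé I.**  Let `g ∈ ℂ[[X]]` satisfy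
`hbar² X² g″ = 12 hbar² g + 6 X² g² + X³ + a X²`, and set
`A := -2 hbar³ + hbar X³ g'`, `B := hbar² + X² g`, and
`h₆ := A²/2 - 2 B³ - (a + X) X⁴ B`.  Then the coefficients of `h₆` of
degree `≤ 4` vanish and the coefficient of degree `5` equals `hbar²`. -/
theorem painleveI_hamiltonian_simple_pole (hbar a : ℂ) (hhbar : hbar ≠ 0)
    (g : PowerSeries ℂ)
    (heq : C (hbar ^ 2) * X ^ 2 * derivative ℂ (derivative ℂ g)
      = 12 * C (hbar ^ 2) * g + 6 * X ^ 2 * g ^ 2 + X ^ 3 + C a * X ^ 2)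
    (A B h₆ : PowerSeries ℂ)
    (hA : A = C (-2 * hbar ^ 3) + C hbar * X ^ 3 * derivative ℂ g)
    (hB : B = C (hbar ^ 2) + X ^ 2 * g)
    (hh₆ : h₆ = A ^ 2 * (2 : ℂ⟦X⟧)⁻¹ - 2 * B ^ 3 - (C a + X) * X ^ 4 * B) :
    (∀ k : ℕ, k ≤ 4 → coeff k h₆ = 0) ∧ coeff 5 h₆ = hbar ^ 2 := by
  have e : ∀ n : ℕ, coeff n (X ^ 2 * (C (hbar ^ 2) * derivative ℂ (derivative ℂ g)))
      = coeff n (C (12 * hbar ^ 2) * g + X ^ 2 * (C 6 * g ^ 2) + X ^ 3 + C a * X ^ 2) := by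
    intro n
    congr 1
    have h6 : (C (6 : ℂ) : ℂ⟦X⟧) = 6 := map_ofNat C 6
    have h12 : (C (12 : ℂ) : ℂ⟦X⟧) = 12 := map_ofNat C 12
    rw [map_mul, h6, h12]
    linear_combination heq
  have hb2 : hbar ^ 2 ≠ 0 := pow_ne_zero 2 hhbar
  have e0 := e 0
  have e1 := e 1
  have e2 := e 2
  have e3 := e 3
  simp only [map_add, coeff_X_pow_mul', coeff_C_mul, coeff_X_pow, coeff_derivative] at e0 e1 e2 e3
  norm_num [hhbar] at e0 e1
  have g0 : coeff 0 g = 0 := by simpa using e0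
  have q0 : coeff 0 (g ^ 2) = 0 := by simp [pow_two, coeff_mul, e0]
  have q1 : coeff 1 (g ^ 2) = 0 := by
    simp [pow_two, coeff_mul, Finset.antidiagonal, Finset.Nat.antidiagonal_succ, e0, e1]
  norm_num [-coeff_zero_eq_constantCoeff, q0, q1] at e2 e3
  have g2 : 10 * hbar ^ 2 * coeff 2 g = -a := by linear_combination -e2
  have g3 : 6 * hbar ^ 2 * coeff 3 g = -1 := by linear_combination -e3
  obtain ⟨r, hr⟩ : ∃ r, g = X ^ 2 * (C (coeff 2 g) + C (coeff 3 g) * X + X ^ 2 * r) := by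
    refine ⟨PowerSeries.mk fun n => coeff (n + 4) g, ?_⟩
    ext n
    rcases n with _ | _ | _ | _ | n
    · simp [e0]
    · simp [coeff_X_pow_mul', e1]
    · simp [coeff_X_pow_mul', coeff_X, coeff_C]
    · simp [coeff_X_pow_mul', coeff_X, coeff_C]
    · simp [coeff_X_pow_mul', coeff_X, coeff_C]
  have hd : derivative ℂ g = X * (2 * C (coeff 2 g) + 3 * C (coeff 3 g) * X
      + X ^ 2 * (4 * r + X * derivative ℂ r)) := by
    conv_lhs => rw [hr]
    simp [Derivation.leibniz, Derivation.leibniz_pow]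
    ring
  generalize derivative ℂ g = d at *
  generalize derivative ℂ r = s at *
  have G2 : 10 * C hbar ^ 2 * C (coeff 2 g) = -(C a : ℂ⟦X⟧) := by
    have := congrArg (C : ℂ →+* ℂ⟦X⟧) g2
    have h10 : (C (10 : ℂ) : ℂ⟦X⟧) = 10 := map_ofNat C 10
    simpa [h10] using this
  have G3 : 6 * C hbar ^ 2 * C (coeff 3 g) = -(1 : ℂ⟦X⟧) := by
    have := congrArg (C : ℂ →+* ℂ⟦X⟧) g3
    have h6 : (C (6 : ℂ) : ℂ⟦X⟧) = 6 := map_ofNat C 6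
    simpa [h6] using this
  have two : (2 : ℂ⟦X⟧) * (2 : ℂ⟦X⟧)⁻¹ = 1 := by
    apply PowerSeries.mul_inv_cancel
    have : constantCoeff (2 : ℂ⟦X⟧) = 2 := map_ofNat _ 2
    rw [this]; norm_num
  have hA' : A = C hbar * (-2 * C hbar ^ 2 + X ^ 3 * d) := by
    have h2 : (C (2 : ℂ) : ℂ⟦X⟧) = 2 := map_ofNat C 2
    rw [hA]; simp [h2]; ring
  have hB' : B = C hbar ^ 2 + X ^ 2 * g := by rw [hB]; simp
  generalize C (coeff 2 g) = c2 at *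
  generalize C (coeff 3 g) = c3 at *
  obtain ⟨R, hR⟩ : ∃ R, h₆ = X ^ 5 * C (hbar ^ 2) + X ^ 6 * R := by
    refine ⟨C hbar ^ 2 * d ^ 2 * (2 : ℂ⟦X⟧)⁻¹
      - 2 * C hbar ^ 4 * (4 * r + X * s) - 6 * C hbar ^ 4 * r
      - X ^ 2 * 6 * C hbar ^ 2 * (c2 + c3 * X + X ^ 2 * r) ^ 2
      - 2 * X ^ 6 * (c2 + c3 * X + X ^ 2 * r) ^ 3
      - (C a + X) * g, ?_⟩
    rw [hh₆, hA', hB', hd, hr, map_pow]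
    linear_combination (2 * C hbar ^ 6 - 2 * C hbar ^ 4 * X ^ 4 * (2 * c2 + 3 * c3 * X
      + X ^ 2 * (4 * r + X * s))) * two - C hbar ^ 2 * X ^ 4 * G2 - 2 * C hbar ^ 2 * X ^ 5 * G3
  rw [hR]
  constructor
  · intro k hk
    simp [coeff_X_pow_mul', show ¬ 5 ≤ k by omega, show ¬ 6 ≤ k by omega]
  · simp [coeff_X_pow_mul']
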